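/- There exists a universal constant c₂ > 0 such that the following holds. Let 0 < ε ≤ 1/10 and δ ≥ ε. Let G* be a set of n points in ℝ^d that is (k,ε,δ)-stable with respect to μ ∈ ℝ^d, let S be an ε-corruption of G*, let G be the set of unchanged indices (|G| ≥ (1−ε)n), and let w* be the uniform weights on G. Then for every w ∈ Δ_{n,ε} with ‖μ_w − μ‖_{2,k} ≥ c₂·δ (computed from S) and every η ∈ (0,1): ‖Σ_{(1−η)w + ηw*} − I‖_{F,k,k} ≤ (1 − η/2)·‖Σ_w − I‖_{F,k,k}. -/

import Mathlib

open Finset MeasureTheory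

/-- Euclidean (`ℓ₂`) norm of a vector in `ℝ^d`. -/
noncomputable def norm2 {d : ℕ} (x : Fin d → ℝ) : ℝ :=
  Real.sqrt (∑ i, (x i) ^ 2)

/-- The `(2,k)`-norm: max `ℓ₂` norm over `k` entries. -/
noncomputable def norm2k {d : ℕ} (k : ℕ) (x : Fin d → ℝ) : ℝ :=
  sSup {r : ℝ | ∃ S : Finset (Fin d), S.card = k ∧ r = Real.sqrt (∑ i ∈ S, (x i) ^ 2)}

/-- The `(F,k,k)`-norm: `‖A‖_{F,k,k}² = max_{|S|=k} Σ_{i∈S} ‖A_i‖_{2,k}²`. -/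
noncomputable def normFkk {d : ℕ} (k : ℕ) (A : Matrix (Fin d) (Fin d) ℝ) : ℝ :=
  Real.sqrt (sSup {r : ℝ | ∃ S : Finset (Fin d), S.card = k ∧
    r = ∑ i ∈ S, (norm2k k (A i)) ^ 2})

/-- The `(F,m)`-norm: max Frobenius norm over `m` entries of the matrix. -/
noncomputable def normFm {d : ℕ} (m : ℕ) (A : Matrix (Fin d) (Fin d) ℝ) : ℝ :=
  sSup {r : ℝ | ∃ Q : Finset (Fin d × Fin d), Q.card = m ∧
    r = Real.sqrt (∑ p ∈ Q, (A p.1 p.2) ^ 2)}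

/-- Frobenius norm. -/
noncomputable def frobNorm {d : ℕ} (A : Matrix (Fin d) (Fin d) ℝ) : ℝ :=
  Real.sqrt (∑ a, ∑ b, (A a b) ^ 2)

/-- Spectral norm (operator `ℓ₂ → ℓ₂` norm). -/
noncomputable def specNorm {d : ℕ} (A : Matrix (Fin d) (Fin d) ℝ) : ℝ :=
  sSup {r : ℝ | ∃ x : Fin d → ℝ, norm2 x = 1 ∧ r = norm2 (A.mulVec x)}

/-- Quadratic form `vᵀ A v`. -/
noncomputable def quadForm {d : ℕ} (A : Matrix (Fin d) (Fin d) ℝ) (v : Fin d → ℝ) : ℝ :=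
  ∑ a, ∑ b, v a * A a b * v b

/-- Ky Fan 2-norm of a symmetric matrix: max of `|uᵀAu| + |vᵀAv|` over orthonormal pairs. -/
noncomputable def kyFan2 {d : ℕ} (A : Matrix (Fin d) (Fin d) ℝ) : ℝ :=
  sSup {r : ℝ | ∃ u v : Fin d → ℝ, norm2 u = 1 ∧ norm2 v = 1 ∧ (∑ i, u i * v i) = 0 ∧
    r = |quadForm A u| + |quadForm A v|}

/-- `x` has at most `k` nonzero entries. -/
def sparseLE {d : ℕ} (k : ℕ) (x : Fin d → ℝ) : Prop :=
  ∃ S : Finset (Fin d), S.card ≤ k ∧ ∀ i, i ∉ S → x i = 0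

/-- `A_Q`: the matrix equal to `A` on the entry set `Q` and zero elsewhere. -/
def matRestrict {d : ℕ} (A : Matrix (Fin d) (Fin d) ℝ) (Q : Finset (Fin d × Fin d)) :
    Matrix (Fin d) (Fin d) ℝ :=
  Matrix.of fun a b => if (a, b) ∈ Q then A a b else 0

/-- `Δ_{n,ε}`. -/
def Delta (n : ℕ) (ε : ℝ) : Set (Fin n → ℝ) :=
  {w | (∑ i, w i) = 1 ∧ ∀ i, 0 ≤ w i ∧ w i ≤ 1 / ((1 - ε) * n)}

/-- Weighted empirical mean `μ_w`. -/
noncomputable def muW {n d : ℕ} (X : Fin n → Fin d → ℝ) (w : Fin n → ℝ) : Fin d → ℝ :=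
  fun j => ∑ i, w i * X i j

/-- Weighted empirical covariance `Σ_w`. -/
noncomputable def SigmaW {n d : ℕ} (X : Fin n → Fin d → ℝ) (w : Fin n → ℝ) :
    Matrix (Fin d) (Fin d) ℝ :=
  Matrix.of fun a b => ∑ i, w i * (X i a - muW X w a) * (X i b - muW X w b)

/-- Weighted second moment `M_w`. -/
noncomputable def MW {n d : ℕ} (X : Fin n → Fin d → ℝ) (w : Fin n → ℝ) :
    Matrix (Fin d) (Fin d) ℝ :=
  Matrix.of fun a b => ∑ i, w i * X i a * X i b

/-- `(k,ε,δ)`-stability for sparse mean estimation. -/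
def stableMean {n d : ℕ} (k : ℕ) (ε δ : ℝ) (X : Fin n → Fin d → ℝ) (μ : Fin d → ℝ) : Prop :=
  ∀ w ∈ Delta n (2 * ε),
    norm2k k (fun j => muW X w j - μ j) ≤ δ ∧ normFkk k (SigmaW X w - 1) ≤ δ ^ 2 / ε

/-- `(ε,δ)`-spectral stability for (non-sparse) mean estimation. -/
def stableSpec {n d : ℕ} (ε δ : ℝ) (X : Fin n → Fin d → ℝ) (μ : Fin d → ℝ) : Prop :=
  ∀ w ∈ Delta n (2 * ε),
    norm2 (fun j => muW X w j - μ j) ≤ δ ∧ specNorm (SigmaW X w - 1) ≤ δ ^ 2 / ε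

/-- `(k,ε,δ)`-stability for sparse PCA. -/
def stablePCA {n d : ℕ} (k : ℕ) (ε δ ρ : ℝ) (X : Fin n → Fin d → ℝ) (v : Fin d → ℝ) : Prop :=
  ∀ w ∈ Delta n (2 * ε),
    normFm (2 * k ^ 2) (MW X w - (1 + ρ • Matrix.vecMulVec v v)) ≤ δ

/-- `(ε,δ)`-KF2-stability for (non-sparse) PCA. -/
def stableKF2 {n d : ℕ} (ε δ ρ : ℝ) (X : Fin n → Fin d → ℝ) (v : Fin d → ℝ) : Prop :=
  ∀ w ∈ Delta n (2 * ε),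
    kyFan2 (MW X w - (1 + ρ • Matrix.vecMulVec v v)) ≤ δ

/-- `X` is an `ε`-corruption of `Xstar`: they differ in at most `εn` indices. -/
def isCorruption {n d : ℕ} (ε : ℝ) (X Xstar : Fin n → Fin d → ℝ) : Prop :=
  ∃ B : Finset (Fin n), (B.card : ℝ) ≤ ε * n ∧ ∀ i, i ∉ B → X i = Xstar i

/-- Uniform weight vector on a finite index set `G`. -/
noncomputable def uniformOn {n : ℕ} (G : Finset (Fin n)) : Fin n → ℝ :=
  fun i => if i ∈ G then ((G.card : ℝ))⁻¹ else 0

section SparseNorms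

variable {ι : Type*}

theorem sqrt_sum_add_sq_le (s : Finset ι) (f g : ι → ℝ) :
    √(∑ i ∈ s, (f i + g i) ^ 2) ≤ √(∑ i ∈ s, f i ^ 2) + √(∑ i ∈ s, g i ^ 2) := by
  have hf : 0 ≤ ∑ i ∈ s, f i ^ 2 := sum_nonneg fun i _ => sq_nonneg _
  have hg : 0 ≤ ∑ i ∈ s, g i ^ 2 := sum_nonneg fun i _ => sq_nonneg _
  have h := Real.sum_mul_le_sqrt_mul_sqrt s f g
  have h2 : ∑ i ∈ s, (f i + g i) ^ 2
      = ∑ i ∈ s, f i ^ 2 + 2 * ∑ i ∈ s, f i * g i + ∑ i ∈ s, g i ^ 2 := by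
    rw [mul_sum, ← sum_add_distrib, ← sum_add_distrib]
    exact sum_congr rfl fun i _ => by ring
  rw [Real.sqrt_le_left (by positivity), h2]
  nlinarith [Real.sq_sqrt hf, Real.sq_sqrt hg]

variable {d k : ℕ}

theorem exists_norm2k_eq (hk : k ≤ d) (x : Fin d → ℝ) :
    ∃ S : Finset (Fin d), S.card = k ∧ norm2k k x = √(∑ i ∈ S, x i ^ 2) := by
  obtain ⟨S₀, -, hS₀⟩ := exists_subset_card_eq (s := (univ : Finset (Fin d))) (n := k) (by simpa)
  refine Set.Nonempty.csSup_mem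
    (s := {r : ℝ | ∃ S : Finset (Fin d), S.card = k ∧ r = √(∑ i ∈ S, x i ^ 2)})
    ⟨_, S₀, hS₀, rfl⟩ ?_
  refine (Set.finite_range fun S : Finset (Fin d) => √(∑ i ∈ S, x i ^ 2)).subset ?_
  rintro _ ⟨S, -, rfl⟩
  exact ⟨S, rfl⟩

theorem sqrt_sum_sq_le_norm2k {S : Finset (Fin d)} (hS : S.card = k) (x : Fin d → ℝ) :
    √(∑ i ∈ S, x i ^ 2) ≤ norm2k k x := by
  refine le_csSup (Set.Finite.bddAbove ?_) ⟨S, hS, rfl⟩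
  refine (Set.finite_range fun S : Finset (Fin d) => √(∑ i ∈ S, x i ^ 2)).subset ?_
  rintro _ ⟨S, -, rfl⟩
  exact ⟨S, rfl⟩

theorem norm2k_nonneg (k : ℕ) (x : Fin d → ℝ) : 0 ≤ norm2k k x := by
  refine Real.sSup_nonneg ?_
  rintro _ ⟨S, -, rfl⟩
  exact Real.sqrt_nonneg _

theorem sum_sq_le_norm2k_sq {S : Finset (Fin d)} (hS : S.card = k) (x : Fin d → ℝ) :
    ∑ i ∈ S, x i ^ 2 ≤ norm2k k x ^ 2 :=
  (Real.sqrt_le_left (norm2k_nonneg k x)).1 (sqrt_sum_sq_le_norm2k hS x)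

theorem norm2k_eq_zero_of_lt (h : d < k) (x : Fin d → ℝ) : norm2k k x = 0 := by
  have : {r : ℝ | ∃ S : Finset (Fin d), S.card = k ∧ r = √(∑ i ∈ S, x i ^ 2)} = ∅ := by
    ext r
    simp only [Set.mem_ofPred_eq, Set.mem_empty_iff_false, iff_false, not_exists, not_and]
    intro S hS
    have := S.card_le_univ
    simp only [Fintype.card_fin] at this
    omega
  rw [norm2k, this, Real.sSup_empty]

theorem norm2k_add_le (hk : k ≤ d) (x y : Fin d → ℝ) :
    norm2k k (fun i => x i + y i) ≤ norm2k k x + norm2k k y := by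
  obtain ⟨S, hS, h⟩ := exists_norm2k_eq hk (fun i => x i + y i)
  rw [h]
  exact (sqrt_sum_add_sq_le S x y).trans
    (add_le_add (sqrt_sum_sq_le_norm2k hS x) (sqrt_sum_sq_le_norm2k hS y))

theorem norm2k_neg (k : ℕ) (x : Fin d → ℝ) : norm2k k (fun i => -x i) = norm2k k x := by
  simp [norm2k]

theorem abs_sum_mul_le_norm2k {S : Finset (Fin d)} (hS : S.card = k) (u x : Fin d → ℝ)
    (hu : ∑ i ∈ S, u i ^ 2 = 1) : |∑ i ∈ S, u i * x i| ≤ norm2k k x := by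
  refine abs_le_of_sq_le_sq ?_ (norm2k_nonneg k x)
  have h := sum_mul_sq_le_sq_mul_sq S u x
  rw [hu, one_mul] at h
  exact h.trans (sum_sq_le_norm2k_sq hS x)

theorem sqrt_sum_sq_le_normFkk (A : Matrix (Fin d) (Fin d) ℝ) {S : Finset (Fin d)}
    (hS : S.card = k) (T : Fin d → Finset (Fin d)) (hT : ∀ i, (T i).card = k) :
    √(∑ p ∈ S.sigma T, A p.1 p.2 ^ 2) ≤ normFkk k A := by
  refine Real.sqrt_le_sqrt ?_
  rw [sum_sigma]
  refine (sum_le_sum fun i _ => sum_sq_le_norm2k_sq (hT i) (A i)).trans ?_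
  refine le_csSup (Set.Finite.bddAbove ?_) ⟨S, hS, rfl⟩
  refine (Set.finite_range fun S : Finset (Fin d) => ∑ i ∈ S, norm2k k (A i) ^ 2).subset ?_
  rintro _ ⟨S, -, rfl⟩
  exact ⟨S, rfl⟩

theorem exists_normFkk_eq (hk : k ≤ d) (A : Matrix (Fin d) (Fin d) ℝ) :
    ∃ (S : Finset (Fin d)) (T : Fin d → Finset (Fin d)), S.card = k ∧ (∀ i, (T i).card = k) ∧
      normFkk k A = √(∑ p ∈ S.sigma T, A p.1 p.2 ^ 2) := by
  obtain ⟨S₀, -, hS₀⟩ := exists_subset_card_eq (s := (univ : Finset (Fin d))) (n := k) (by simpa)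
  have hmem := Set.Nonempty.csSup_mem
    (s := {r : ℝ | ∃ S : Finset (Fin d), S.card = k ∧ r = ∑ i ∈ S, norm2k k (A i) ^ 2})
    ⟨_, S₀, hS₀, rfl⟩ (by
      refine (Set.finite_range fun S : Finset (Fin d) => ∑ i ∈ S, norm2k k (A i) ^ 2).subset ?_
      rintro _ ⟨S, -, rfl⟩
      exact ⟨S, rfl⟩)
  obtain ⟨S, hS, hA⟩ := hmem
  choose T hT hTA using fun i => exists_norm2k_eq hk (A i)
  refine ⟨S, T, hS, hT, ?_⟩
  rw [normFkk, hA, sum_sigma]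
  congr 1
  refine sum_congr rfl fun i _ => ?_
  rw [hTA i, Real.sq_sqrt (sum_nonneg fun j _ => sq_nonneg _)]

theorem normFkk_nonneg (k : ℕ) (A : Matrix (Fin d) (Fin d) ℝ) : 0 ≤ normFkk k A :=
  Real.sqrt_nonneg _

theorem normFkk_add_le (hk : k ≤ d) (A B : Matrix (Fin d) (Fin d) ℝ) :
    normFkk k (A + B) ≤ normFkk k A + normFkk k B := by
  obtain ⟨S, T, hS, hT, h⟩ := exists_normFkk_eq hk (A + B)
  rw [h]
  exact (sqrt_sum_add_sq_le (S.sigma T) (fun p => A p.1 p.2) fun p => B p.1 p.2).trans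
    (add_le_add (sqrt_sum_sq_le_normFkk A hS T hT) (sqrt_sum_sq_le_normFkk B hS T hT))

theorem normFkk_smul_le (hk : k ≤ d) {c : ℝ} (hc : 0 ≤ c) (A : Matrix (Fin d) (Fin d) ℝ) :
    normFkk k (c • A) ≤ c * normFkk k A := by
  obtain ⟨S, T, hS, hT, h⟩ := exists_normFkk_eq hk (c • A)
  rw [h]
  refine le_trans (le_of_eq ?_)
    (mul_le_mul_of_nonneg_left (sqrt_sum_sq_le_normFkk A hS T hT) hc)
  simp only [Matrix.smul_apply, smul_eq_mul, mul_pow]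
  rw [← mul_sum, Real.sqrt_mul (sq_nonneg c), Real.sqrt_sq hc]

theorem normFkk_vecMulVec_le (hk : k ≤ d) (x : Fin d → ℝ) :
    normFkk k (Matrix.vecMulVec x x) ≤ norm2k k x ^ 2 := by
  obtain ⟨S, T, hS, hT, h⟩ := exists_normFkk_eq hk (Matrix.vecMulVec x x)
  rw [h, Real.sqrt_le_left (sq_nonneg _), sum_sigma]
  simp only [Matrix.vecMulVec_apply, mul_pow]
  calc ∑ i ∈ S, ∑ j ∈ T i, x i ^ 2 * x j ^ 2
      ≤ ∑ i ∈ S, x i ^ 2 * norm2k k x ^ 2 := by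
        refine sum_le_sum fun i _ => ?_
        rw [← mul_sum]
        exact mul_le_mul_of_nonneg_left (sum_sq_le_norm2k_sq (hT i) x) (sq_nonneg _)
    _ ≤ (norm2k k x ^ 2) ^ 2 := by
        rw [← sum_mul, sq (norm2k k x ^ 2)]
        exact mul_le_mul_of_nonneg_right (sum_sq_le_norm2k_sq hS x) (sq_nonneg _)

/-- A sparse unit vector tests the `(F,k,k)`-norm from below. -/
theorem abs_quadratic_le_normFkk (A : Matrix (Fin d) (Fin d) ℝ) {S : Finset (Fin d)}
    (hS : S.card = k) (u : Fin d → ℝ) (hu : ∑ i ∈ S, u i ^ 2 = 1) :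
    |∑ a ∈ S, ∑ b ∈ S, u a * u b * A a b| ≤ normFkk k A := by
  refine abs_le_of_sq_le_sq ?_ (normFkk_nonneg k A)
  have h := sum_mul_sq_le_sq_mul_sq (S.sigma fun _ => S) (fun p => u p.1 * u p.2)
    fun p => A p.1 p.2
  have h1 : ∑ p ∈ S.sigma fun _ => S, (u p.1 * u p.2) ^ 2 = 1 := by
    rw [sum_sigma]
    simp only [mul_pow, ← mul_sum, hu, mul_one]
  rw [h1, one_mul, sum_sigma] at h
  exact h.trans ((Real.sqrt_le_left (normFkk_nonneg k A)).1
    (sqrt_sum_sq_le_normFkk A hS (fun _ => S) fun _ => hS))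

end SparseNorms

section WeightedMoments

variable {n d : ℕ}

theorem SigmaW_apply (X : Fin n → Fin d → ℝ) {w : Fin n → ℝ} (hw : ∑ i, w i = 1)
    (a b : Fin d) :
    SigmaW X w a b = ∑ i, w i * X i a * X i b - muW X w a * muW X w b := by
  have h : ∀ i, w i * (X i a - muW X w a) * (X i b - muW X w b)
      = w i * X i a * X i b - muW X w b * (w i * X i a) - muW X w a * (w i * X i b)
        + muW X w a * muW X w b * w i := fun i => by ring
  simp only [SigmaW, Matrix.of_apply, h, sum_add_distrib, sum_sub_distrib, ← mul_sum, hw]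
  simp only [muW]
  ring

theorem muW_congr {X Y : Fin n → Fin d → ℝ} {w : Fin n → ℝ}
    (h : ∀ i, w i ≠ 0 → X i = Y i) : muW X w = muW Y w := by
  funext j
  refine sum_congr rfl fun i _ => ?_
  by_cases hi : w i = 0
  · simp [hi]
  · rw [h i hi]

theorem SigmaW_congr {X Y : Fin n → Fin d → ℝ} {w : Fin n → ℝ}
    (h : ∀ i, w i ≠ 0 → X i = Y i) : SigmaW X w = SigmaW Y w := by
  ext a b
  simp only [SigmaW, Matrix.of_apply, muW_congr h]
  refine sum_congr rfl fun i _ => ?_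
  by_cases hi : w i = 0
  · simp [hi]
  · rw [h i hi]

theorem SigmaW_mix (X : Fin n → Fin d → ℝ) {w v : Fin n → ℝ} (hw : ∑ i, w i = 1)
    (hv : ∑ i, v i = 1) (η : ℝ) :
    SigmaW X (fun i => (1 - η) * w i + η * v i) - 1
      = (1 - η) • (SigmaW X w - 1) + η • (SigmaW X v - 1)
        + (η * (1 - η)) • Matrix.vecMulVec (fun j => muW X w j - muW X v j)
          (fun j => muW X w j - muW X v j) := by
  have hmix : ∑ i, ((1 - η) * w i + η * v i) = 1 := by
    rw [sum_add_distrib, ← mul_sum, ← mul_sum, hw, hv]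
    ring
  have hmu : ∀ j, muW X (fun i => (1 - η) * w i + η * v i) j
      = (1 - η) * muW X w j + η * muW X v j := fun j => by
    simp only [muW, mul_sum, ← sum_add_distrib]
    exact sum_congr rfl fun i _ => by ring
  have hsum : ∀ a b, ∑ i, ((1 - η) * w i + η * v i) * X i a * X i b
      = (1 - η) * ∑ i, w i * X i a * X i b + η * ∑ i, v i * X i a * X i b := fun a b => by
    simp only [mul_sum, ← sum_add_distrib]
    exact sum_congr rfl fun i _ => by ring
  ext a b
  simp only [Matrix.sub_apply, Matrix.add_apply, Matrix.smul_apply, smul_eq_mul,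
    Matrix.vecMulVec_apply, SigmaW_apply X hmix, SigmaW_apply X hw, SigmaW_apply X hv, hmu, hsum]
  ring

theorem sum_mul_muW (X : Fin n → Fin d → ℝ) (w : Fin n → ℝ) (S : Finset (Fin d))
    (u : Fin d → ℝ) :
    ∑ a ∈ S, u a * muW X w a = ∑ i, w i * ∑ a ∈ S, u a * X i a := by
  simp only [muW, mul_sum]
  rw [sum_comm]
  exact sum_congr rfl fun i _ => sum_congr rfl fun a _ => by ring

theorem quadratic_SigmaW_sub_one (X : Fin n → Fin d → ℝ) (w : Fin n → ℝ) (S : Finset (Fin d))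
    (u : Fin d → ℝ) (hu : ∑ i ∈ S, u i ^ 2 = 1) :
    ∑ a ∈ S, ∑ b ∈ S, u a * u b * (SigmaW X w - 1) a b
      = ∑ i, w i * (∑ a ∈ S, u a * X i a - ∑ a ∈ S, u a * muW X w a) ^ 2 - 1 := by
  have hone : ∑ a ∈ S, ∑ b ∈ S, u a * u b * (1 : Matrix (Fin d) (Fin d) ℝ) a b = 1 := by
    rw [← hu]
    refine sum_congr rfl fun a ha => ?_
    rw [sum_eq_single_of_mem a ha fun b _ hb => by rw [Matrix.one_apply_ne hb.symm, mul_zero]]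
    rw [Matrix.one_apply_eq]
    ring
  simp only [Matrix.sub_apply, mul_sub, sum_sub_distrib, hone]
  congr 1
  simp only [SigmaW, Matrix.of_apply, mul_sum]
  simp only [sum_comm (s := S) (t := univ)]
  refine sum_congr rfl fun i _ => ?_
  rw [← sum_sub_distrib, sq, sum_mul_sum, mul_sum]
  refine sum_congr rfl fun a _ => ?_
  rw [mul_sum]
  exact sum_congr rfl fun b _ => by ring

theorem uniformOn_mem_Delta {ε : ℝ} (hε : ε < 1) (G : Finset (Fin n)) (hn : 0 < n)
    (hG : (1 - ε) * n ≤ (G.card : ℝ)) : uniformOn G ∈ Delta n ε := by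
  have hn' : (0 : ℝ) < n := by exact_mod_cast hn
  have hpos : 0 < (1 - ε) * n := mul_pos (by linarith) hn'
  have hc : (0 : ℝ) < G.card := hpos.trans_le hG
  refine ⟨?_, fun i => ?_⟩
  · simp [uniformOn, hc.ne']
  · unfold uniformOn
    split_ifs
    · exact ⟨by positivity, by rw [← one_div]; exact one_div_le_one_div_of_le hpos hG⟩
    · exact ⟨le_rfl, by positivity⟩

theorem Delta_mono {ε ε' : ℝ} (h : ε ≤ ε') (h' : ε' < 1) (hn : 0 < n) :
    Delta n ε ⊆ Delta n ε' := by
  have hn' : (0 : ℝ) < n := by exact_mod_cast hn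
  intro w hw
  refine ⟨hw.1, fun i => ⟨(hw.2 i).1, (hw.2 i).2.trans ?_⟩⟩
  exact one_div_le_one_div_of_le (mul_pos (by linarith) hn')
    (mul_le_mul_of_nonneg_right (by linarith) hn'.le)

/-- The weights `w` conditioned on the index set `G`. -/
noncomputable def condWeights (G : Finset (Fin n)) (w : Fin n → ℝ) : Fin n → ℝ :=
  fun i => if i ∈ G then w i / ∑ j ∈ G, w j else 0

theorem sum_compl_le_of_mem_Delta {ε : ℝ} (hε : ε < 1) (hn : 0 < n) {w : Fin n → ℝ}
    (hw : w ∈ Delta n ε) (G : Finset (Fin n)) (hG : (1 - ε) * n ≤ (G.card : ℝ)) :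
    (1 - ε) * ∑ i ∈ Gᶜ, w i ≤ ε := by
  have hn' : (0 : ℝ) < n := by exact_mod_cast hn
  have h1 : ∑ i ∈ Gᶜ, w i ≤ Gᶜ.card • (1 / ((1 - ε) * n)) :=
    sum_le_card_nsmul _ _ _ fun i _ => (hw.2 i).2
  have hcard : (Gᶜ.card : ℝ) = n - G.card := by
    rw [card_compl, Fintype.card_fin, Nat.cast_sub (by simpa using G.card_le_univ)]
  rw [nsmul_eq_mul, hcard] at h1
  have hε' : 0 < 1 - ε := by linarith
  calc (1 - ε) * ∑ i ∈ Gᶜ, w i ≤ (1 - ε) * ((n - G.card) * (1 / ((1 - ε) * n))) :=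
        mul_le_mul_of_nonneg_left h1 hε'.le
    _ = (n - G.card) / n := by field_simp
    _ ≤ ε := by rw [div_le_iff₀ hn']; linarith

theorem condWeights_mem_Delta {ε : ℝ} (hε : 2 * ε < 1) (hn : 0 < n)
    {w : Fin n → ℝ} (hw : w ∈ Delta n ε) (G : Finset (Fin n))
    (hG : (1 - ε) * n ≤ (G.card : ℝ)) : condWeights G w ∈ Delta n (2 * ε) := by
  have hn' : (0 : ℝ) < n := by exact_mod_cast hn
  have hα := sum_compl_le_of_mem_Delta (by linarith) hn hw G hG
  have hsplit := sum_add_sum_compl G w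
  rw [hw.1] at hsplit
  have hs : 1 - 2 * ε ≤ (1 - ε) * ∑ i ∈ G, w i := by
    rw [eq_sub_of_add_eq hsplit]; linarith
  have hs0 : 0 < ∑ i ∈ G, w i := by
    by_contra! h
    nlinarith
  refine ⟨?_, fun i => ?_⟩
  · simp [condWeights, ← sum_div, hs0.ne']
  · have h0 : (0 : ℝ) < (1 - 2 * ε) * n := mul_pos (by linarith) hn'
    unfold condWeights
    split_ifs
    · refine ⟨div_nonneg (hw.2 i).1 hs0.le, ?_⟩
      have hε1 : 0 < 1 - ε := by linarith
      calc w i / ∑ j ∈ G, w j ≤ 1 / ((1 - ε) * n) / ∑ j ∈ G, w j :=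
            div_le_div_of_nonneg_right (hw.2 i).2 hs0.le
        _ = 1 / (((1 - ε) * ∑ j ∈ G, w j) * n) := by field_simp
        _ ≤ 1 / ((1 - 2 * ε) * n) :=
            one_div_le_one_div_of_le h0 (mul_le_mul_of_nonneg_right hs hn'.le)
    · exact ⟨le_rfl, by positivity⟩

theorem sum_condWeights_mul (G : Finset (Fin n)) (w f : Fin n → ℝ) :
    ∑ i, condWeights G w i * f i = (∑ i ∈ G, w i * f i) / ∑ i ∈ G, w i := by
  simp only [condWeights, ite_mul, zero_mul, sum_ite_mem, univ_inter, sum_div]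
  exact sum_congr rfl fun i _ => by ring

/-- Weighted variance dominates the variance within `G` plus the part forced by the displacement
of the overall mean `m` from the mean `g` within `G`. -/
theorem weighted_variance_lower_bound {w : Fin n → ℝ} (hw : ∀ i, 0 ≤ w i) (hw1 : ∑ i, w i = 1)
    (G : Finset (Fin n)) (hs : 0 < ∑ i ∈ G, w i) (y : Fin n → ℝ) {g m : ℝ}
    (hg : g = ∑ i, condWeights G w i * y i) (hm : m = ∑ i, w i * y i) :
    (∑ i ∈ Gᶜ, w i) * ((∑ i ∈ G, w i) * ∑ i, condWeights G w i * (y i - g) ^ 2)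
        + (∑ i ∈ G, w i) ^ 2 * (m - g) ^ 2
      ≤ (∑ i ∈ Gᶜ, w i) * ∑ i, w i * (y i - m) ^ 2 := by
  have hα : 0 ≤ ∑ i ∈ Gᶜ, w i := sum_nonneg fun i _ => hw i
  have hsplit := sum_add_sum_compl G w
  have hsplitm := sum_add_sum_compl G fun i => w i * y i
  rw [hw1] at hsplit
  rw [← hm] at hsplitm
  have hg' : ∑ i ∈ G, w i * y i = g * ∑ i ∈ G, w i := by
    rw [hg, sum_condWeights_mul, div_mul_cancel₀ _ hs.ne']
  rw [sum_condWeights_mul G w fun i => (y i - g) ^ 2, mul_div_cancel₀ _ hs.ne',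
    ← sum_add_sum_compl G fun i => w i * (y i - m) ^ 2, mul_add]
  have hgood : ∑ i ∈ G, w i * (y i - g) ^ 2 ≤ ∑ i ∈ G, w i * (y i - m) ^ 2 := by
    have h : ∑ i ∈ G, w i * (y i - m) ^ 2 - ∑ i ∈ G, w i * (y i - g) ^ 2
        = (∑ i ∈ G, w i) * (m - g) ^ 2 := by
      have : ∀ i, w i * (y i - m) ^ 2 - w i * (y i - g) ^ 2
          = (m ^ 2 - g ^ 2) * w i - 2 * (m - g) * (w i * y i) := fun i => by ring
      rw [← sum_sub_distrib]
      simp only [this, sum_sub_distrib, ← mul_sum, hg']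
      ring
    nlinarith [mul_nonneg hs.le (sq_nonneg (m - g))]
  have hbad : (∑ i ∈ G, w i) ^ 2 * (m - g) ^ 2
      ≤ (∑ i ∈ Gᶜ, w i) * ∑ i ∈ Gᶜ, w i * (y i - m) ^ 2 := by
    have h : ∑ i ∈ Gᶜ, w i * (y i - m) = (∑ i ∈ G, w i) * (m - g) := by
      simp only [mul_sub, sum_sub_distrib, ← sum_mul]
      rw [eq_sub_of_add_eq' hsplitm, eq_sub_of_add_eq' hsplit, hg']
      ring
    rw [← mul_pow, ← h]
    exact sum_sq_le_sum_mul_sum_of_sq_le_mul _ (fun i _ => hw i)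
      (fun i _ => mul_nonneg (hw i) (sq_nonneg _)) fun i _ => le_of_eq (by ring)
  exact add_le_add (mul_le_mul_of_nonneg_left hgood hα) hbad

/-- The numerical combination behind `mean_error_sq_le_normFkk`. -/
theorem sq_le_of_variance_bound {ε δ α D N V V' m g p : ℝ} (hε : 0 < ε) (hε1 : ε ≤ 1 / 10)
    (hεδ : ε ≤ δ) (hα0 : 0 ≤ α) (hα : (1 - ε) * α ≤ ε) (hN : 0 ≤ N) (hfar : 10 * δ ≤ D)
    (hproj : m - p = D) (hmean : g - p ≤ δ) (hcov : -(δ ^ 2 / ε) ≤ V - 1) (hobj : V' - 1 ≤ N)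
    (hvar : α * ((1 - α) * V) + (1 - α) ^ 2 * (m - g) ^ 2 ≤ α * V') :
    D ^ 2 ≤ 2 * ε * N := by
  have hαε : α ≤ 10 / 9 * ε := by nlinarith
  have hεr : ε ≤ δ ^ 2 / ε := by
    rw [le_div_iff₀ hε]
    nlinarith
  have hrε : ε * (δ ^ 2 / ε) = δ ^ 2 := mul_div_cancel₀ _ hε.ne'
  set r := δ ^ 2 / ε
  have hα1 : α ≤ 1 / 9 := by linarith
  have hgap : 81 / 100 * D ^ 2 ≤ (m - g) ^ 2 := by nlinarith
  have hs2 : 64 / 81 ≤ (1 - α) ^ 2 := by nlinarith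
  have hleft : 64 / 100 * D ^ 2 ≤ (1 - α) ^ 2 * (m - g) ^ 2 := by
    have := mul_le_mul hs2 hgap (by positivity) (by positivity)
    linarith
  have hV : (1 - α) * (1 - r) ≤ (1 - α) * V :=
    mul_le_mul_of_nonneg_left (by linarith) (by linarith)
  have hbound : V' - (1 - α) * V ≤ N + 19 / 9 * r := by
    have : 0 ≤ α * r := mul_nonneg hα0 (hε.le.trans hεr)
    linarith
  have hright : α * (V' - (1 - α) * V) ≤ 10 / 9 * ε * (N + 19 / 9 * r) :=
    mul_le_mul_of_nonneg_left hbound hα0 |>.trans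
      (mul_le_mul_of_nonneg_right hαε (by linarith))
  have hδD : δ ^ 2 ≤ D ^ 2 / 100 := by nlinarith
  have hεN : 0 ≤ ε * N := mul_nonneg hε.le hN
  linarith

/-- A large error of the weighted mean forces a large covariance objective. -/
theorem mean_error_sq_le_normFkk {k : ℕ} {ε δ : ℝ} {μ : Fin d → ℝ} {Xstar X : Fin n → Fin d → ℝ}
    {G : Finset (Fin n)} (hε : 0 < ε) (hε1 : ε ≤ 1 / 10) (hεδ : ε ≤ δ) (hn : 0 < n) (hk : k ≤ d)
    (hstable : stableMean k ε δ Xstar μ) (hX : ∀ i ∈ G, X i = Xstar i)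
    (hG : (1 - ε) * n ≤ (G.card : ℝ)) {w : Fin n → ℝ} (hw : w ∈ Delta n ε)
    (hfar : 10 * δ ≤ norm2k k (fun j => muW X w j - μ j)) :
    norm2k k (fun j => muW X w j - μ j) ^ 2 ≤ 2 * ε * normFkk k (SigmaW X w - 1) := by
  obtain ⟨S, hS, hD⟩ := exists_norm2k_eq hk fun j => muW X w j - μ j
  set D := norm2k k fun j => muW X w j - μ j with hDdef
  have hδ : 0 < δ := hε.trans_le hεδ
  have hD0 : 0 < D := by linarith
  have hDsq : ∑ i ∈ S, (muW X w i - μ i) ^ 2 = D ^ 2 := by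
    rw [hD, Real.sq_sqrt (sum_nonneg fun i _ => sq_nonneg _)]
  set u : Fin d → ℝ := fun i => (muW X w i - μ i) / D with hudef
  have hu : ∑ i ∈ S, u i ^ 2 = 1 := by
    simp only [hudef, div_pow, ← sum_div, hDsq]
    exact div_self (by positivity)
  have hproj : ∑ i ∈ S, u i * muW X w i - ∑ i ∈ S, u i * μ i = D := by
    rw [← sum_sub_distrib, eq_comm, ← mul_right_inj' hD0.ne', ← sq, ← hDsq, mul_sum]
    refine sum_congr rfl fun i _ => ?_
    simp only [hudef]
    field_simp
  have hstab := hstable _ (condWeights_mem_Delta (by linarith) hn hw G hG)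
  have hcongr : ∀ i, condWeights G w i ≠ 0 → X i = Xstar i := fun i hi =>
    hX i (by by_contra h; exact hi (if_neg h))
  rw [← muW_congr hcongr, ← SigmaW_congr hcongr] at hstab
  have hmean := (abs_le.1 ((abs_sum_mul_le_norm2k hS u _ hu).trans hstab.1)).2
  have hcov := (abs_le.1 ((abs_quadratic_le_normFkk _ hS u hu).trans hstab.2)).1
  have hobj := (abs_le.1 (abs_quadratic_le_normFkk (SigmaW X w - 1) hS u hu)).2
  simp only [mul_sub, sum_sub_distrib] at hmean
  rw [quadratic_SigmaW_sub_one X _ S u hu] at hcov hobj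
  have hα := sum_compl_le_of_mem_Delta (by linarith) hn hw G hG
  have hsplit := sum_add_sum_compl G w
  rw [hw.1] at hsplit
  have hα0 : 0 ≤ ∑ i ∈ Gᶜ, w i := sum_nonneg fun i _ => (hw.2 i).1
  have hs0 : 0 < ∑ i ∈ G, w i := by
    by_contra! h
    nlinarith
  have hvar := weighted_variance_lower_bound (fun i => (hw.2 i).1) hw.1 G hs0
    (fun i => ∑ a ∈ S, u a * X i a) (sum_mul_muW X (condWeights G w) S u) (sum_mul_muW X w S u)
  rw [eq_sub_of_add_eq hsplit] at hvar
  exact sq_le_of_variance_bound hε hε1 hεδ hα0 hα (normFkk_nonneg _ _) hfar hproj hmean hcov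
    hobj hvar

end WeightedMoments

/-- if `μ_w` is far from `μ`, moving the weights toward the uniform weights
on the good samples decreases the objective `‖Σ_w − I‖_{F,k,k}` geometrically. -/
theorem stmt5 :
    ∃ c₂ > (0:ℝ),
      ∀ (n d k : ℕ) (ε δ : ℝ) (μ : Fin d → ℝ) (Xstar X : Fin n → Fin d → ℝ)
        (G : Finset (Fin n)) (wstar : Fin n → ℝ),
        0 < ε → ε ≤ 1/10 → ε ≤ δ →
        stableMean k ε δ Xstar μ →
        isCorruption ε X Xstar →
        (∀ i ∈ G, X i = Xstar i) →
        (1 - ε) * n ≤ (G.card : ℝ) →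
        wstar = uniformOn G →
        ∀ w ∈ Delta n ε,
          c₂ * δ ≤ norm2k k (fun j => muW X w j - μ j) →
          ∀ η : ℝ, 0 < η → η < 1 →
            normFkk k (SigmaW X (fun i => (1 - η) * w i + η * wstar i) - 1)
              ≤ (1 - η / 2) * normFkk k (SigmaW X w - 1) := by
  refine ⟨10, by norm_num, ?_⟩
  rintro n d k ε δ μ Xstar X G _ hε hε1 hεδ hstable - hX hG rfl w hw hfar η hη hη1
  have hδ : 0 < δ := hε.trans_le hεδ
  have hn : 0 < n := by
    rcases Nat.eq_zero_or_pos n with rfl | hn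
    · exact absurd hw.1 (by simp)
    · exact hn
  have hk : k ≤ d := by
    by_contra! h
    rw [norm2k_eq_zero_of_lt h] at hfar
    linarith
  have hstarΔ := uniformOn_mem_Delta (by linarith) G hn hG
  have hstab := hstable _ (Delta_mono (by linarith) (by linarith) hn hstarΔ)
  have hcongr : ∀ i, uniformOn G i ≠ 0 → X i = Xstar i := fun i hi =>
    hX i (by by_contra h; exact hi (if_neg h))
  rw [← muW_congr hcongr, ← SigmaW_congr hcongr] at hstab
  have hmain := mean_error_sq_le_normFkk hε hε1 hεδ hn hk hstable hX hG hw hfar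
  have hdist : norm2k k (fun j => muW X w j - muW X (uniformOn G) j)
      ≤ norm2k k (fun j => muW X w j - μ j) + δ := by
    have h := norm2k_add_le hk (fun j => muW X w j - μ j)
      fun j => -(muW X (uniformOn G) j - μ j)
    rw [norm2k_neg] at h
    refine le_trans (le_of_eq ?_) (h.trans (add_le_add le_rfl hstab.1))
    congr 1
    funext j
    ring
  rw [SigmaW_mix X hw.1 hstarΔ.1]
  refine (normFkk_add_le hk _ _).trans ((add_le_add ((normFkk_add_le hk _ _).trans
    (add_le_add (normFkk_smul_le hk (by linarith) _) (normFkk_smul_le hk hη.le _)))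
    (normFkk_smul_le hk (mul_nonneg hη.le (by linarith)) _)).trans ?_)
  have hrank := normFkk_vecMulVec_le hk fun j => muW X w j - muW X (uniformOn G) j
  have hnn := norm2k_nonneg k fun j => muW X w j - muW X (uniformOn G) j
  set E := norm2k k fun j => muW X w j - muW X (uniformOn G) j
  set D := norm2k k fun j => muW X w j - μ j
  set N := normFkk k (SigmaW X w - 1)
  set R := normFkk k (Matrix.vecMulVec (fun j => muW X w j - muW X (uniformOn G) j)
    fun j => muW X w j - muW X (uniformOn G) j)
  set Q := normFkk k (SigmaW X (uniformOn G) - 1)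
  have hR0 : 0 ≤ R := normFkk_nonneg _ _
  have hkey : Q + R ≤ N / 2 := by
    have hED : E ^ 2 ≤ 121 / 100 * D ^ 2 := by nlinarith
    have hδD : δ ^ 2 ≤ D ^ 2 / 100 := by nlinarith
    have hQ : ε * Q ≤ δ ^ 2 := by
      have := mul_le_mul_of_nonneg_left hstab.2 hε.le
      rwa [mul_div_cancel₀ _ hε.ne'] at this
    have hR : ε * R ≤ 1 / 10 * (121 / 100 * D ^ 2) :=
      mul_le_mul hε1 (hrank.trans hED) hR0 (by norm_num)
    refine le_of_mul_le_mul_left ?_ hε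
    nlinarith
  nlinarith [mul_nonneg (mul_nonneg hη.le hη.le) hR0]
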